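/- arXiv:1501.06780 — 4 statements merged into one kernel-verified Lean document; each statement's English description precedes it below -/
import Mathlib

section
/- Let m ≥ 1 be an integer and let k̂ > 0 be a real number. Then the function t ↦ exp(k̂·(log t)^m) is convex on the interval [1, ∞) if and only if k̂ ≥ 1/m^(m+1). (In particular, for m = 2 this threshold is 1/8 and for m = 3 it is 1/81.) -/
theorem hasDerivAt_exp_mul_log_pow (n : ℕ) (k : ℝ) {x : ℝ} (hx : x ≠ 0) :
    HasDerivAt (fun t : ℝ => Real.exp (k * Real.log t ^ (n + 1)))
      (Real.exp (k * Real.log x ^ (n + 1)) * (k * (n + 1) * Real.log x ^ n / x)) x := by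
  refine (((Real.hasDerivAt_log hx).fun_pow (n + 1)).const_mul k).exp.congr_deriv ?_
  simp only [Nat.add_sub_cancel, Nat.cast_add, Nat.cast_one]
  ring

theorem hasDerivAt_deriv_exp_mul_log_pow (n : ℕ) (k : ℝ) {x : ℝ} (hx : 1 < x) :
    HasDerivAt
      (fun t : ℝ => Real.exp (k * Real.log t ^ (n + 1)) * (k * (n + 1) * Real.log t ^ n / t))
      (Real.exp (k * Real.log x ^ (n + 1)) * (k * (n + 1)) * Real.log x ^ n /
          (x ^ 2 * Real.log x) *
        (k * (n + 1) * Real.log x ^ (n + 1) + n - Real.log x)) x := by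
  have hx0 : x ≠ 0 := by positivity
  have hL : Real.log x ≠ 0 := (Real.log_pos hx).ne'
  refine ((hasDerivAt_exp_mul_log_pow n k hx0).fun_mul
    ((((Real.hasDerivAt_log hx0).fun_pow n).const_mul (k * (n + 1))).fun_div
      (hasDerivAt_id' x) hx0)).congr_deriv ?_
  cases n with
  | zero =>
    simp
    field_simp
    ring
  | succ n =>
    simp only [Nat.add_sub_cancel, Nat.cast_add, Nat.cast_one]
    field_simp
    ring

theorem convexOn_exp_mul_log_pow_iff_forall (n : ℕ) {k : ℝ} (hk : 0 < k) :
    ConvexOn ℝ (Set.Ici (1 : ℝ)) (fun t : ℝ => Real.exp (k * Real.log t ^ (n + 1))) ↔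
      ∀ u : ℝ, 0 < u → 0 ≤ k * (n + 1) * u ^ (n + 1) + n - u := by
  constructor
  · intro h u hu
    have hx : 1 < Real.exp u := Real.one_lt_exp_iff.2 hu
    have hd : ∀ x ∈ Set.Ioi (1 : ℝ), HasDerivAt _ _ x := fun x hx =>
      hasDerivAt_exp_mul_log_pow n k (zero_lt_one.trans hx).ne'
    have hmono := (h.subset Set.Ioi_subset_Ici_self (convex_Ioi 1)).monotoneOn_deriv
      fun x hx => (hd x hx).differentiableAt
    have hmono' := hmono.congr fun x hx => (hd x hx).deriv
    have h2 := hmono'.derivWithin_nonneg (x := Real.exp u)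
    rw [derivWithin_of_isOpen isOpen_Ioi hx, (hasDerivAt_deriv_exp_mul_log_pow n k hx).deriv,
      Real.log_exp] at h2
    exact nonneg_of_mul_nonneg_right h2 (by positivity)
  · intro h
    refine convexOn_of_hasDerivWithinAt2_nonneg (convex_Ici 1)
      (fun x hx => (hasDerivAt_exp_mul_log_pow n k
        (zero_lt_one.trans_le hx).ne').continuousAt.continuousWithinAt)
      (f' := fun t => Real.exp (k * Real.log t ^ (n + 1)) * (k * (n + 1) * Real.log t ^ n / t))
      (f'' := fun x => Real.exp (k * Real.log x ^ (n + 1)) * (k * (n + 1)) * Real.log x ^ n /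
          (x ^ 2 * Real.log x) * (k * (n + 1) * Real.log x ^ (n + 1) + n - Real.log x))
      ?_ ?_ ?_ <;> rw [interior_Ici] <;> intro x (hx : 1 < x)
    · exact (hasDerivAt_exp_mul_log_pow n k (by positivity)).hasDerivWithinAt
    · exact (hasDerivAt_deriv_exp_mul_log_pow n k hx).hasDerivWithinAt
    · have hL := Real.log_pos hx
      exact mul_nonneg (by positivity) (h _ hL)

/-- For an integer `m ≥ 1` and a real `k̂ > 0`, the function `t ↦ exp(k̂ (log t)^m)`
is convex on `[1, ∞)` if and only if `k̂ ≥ 1 / m^(m+1)`. -/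
theorem convexOn_exp_pow_log_iff (m : ℕ) (hm : 1 ≤ m) (khat : ℝ) (hkhat : 0 < khat) :
    ConvexOn ℝ (Set.Ici (1 : ℝ)) (fun t : ℝ => Real.exp (khat * (Real.log t) ^ m)) ↔
      khat ≥ 1 / (m : ℝ) ^ (m + 1) := by
  obtain ⟨n, rfl⟩ := Nat.exists_eq_add_of_le' hm
  have hM : (0 : ℝ) < n + 1 := by positivity
  rw [convexOn_exp_mul_log_pow_iff_forall n hkhat, ge_iff_le]
  push_cast
  rw [div_le_iff₀ (by positivity)]
  constructor
  · intro h
    have := h (n + 1) hM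
    rw [pow_succ ((n : ℝ) + 1) (n + 1)]
    linarith
  · intro h u hu
    have hB := one_add_mul_sub_le_pow (a := u / (n + 1))
      (by linarith [div_pos hu hM]) (n + 1)
    have hlin : 1 + ((n + 1 : ℕ) : ℝ) * (u / (n + 1) - 1) = u - n := by
      push_cast
      field_simp
      ring
    have hp := mul_le_mul_of_nonneg_right h (pow_nonneg (div_pos hu hM).le (n + 1))
    have he : khat * ((n : ℝ) + 1) ^ (n + 1 + 1) * (u / (n + 1)) ^ (n + 1) =
        khat * (n + 1) * u ^ (n + 1) := by
      rw [div_pow]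
      field_simp
      ring
    linarith
end

section
/- Let k̂ > 0 be a real number. Then the function t ↦ exp(k̂·(log t)²) is convex on the open interval (0, ∞) if and only if k̂ ≥ 1/8. -/
open Set

/-- First derivative of `t ↦ exp (k (log t)²)`. -/
theorem hasDerivAt_exp_mul_sq_log (k : ℝ) {t : ℝ} (ht : 0 < t) :
    HasDerivAt (fun t : ℝ => Real.exp (k * (Real.log t) ^ 2))
      (Real.exp (k * (Real.log t) ^ 2) * (2 * k * Real.log t / t)) t := by
  have h := (((Real.hasDerivAt_log ht.ne').pow 2).const_mul k).exp
  refine h.congr_deriv ?_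
  simp only [Pi.pow_apply]
  field_simp
  norm_num
  ring

/-- Second derivative of `t ↦ exp (k (log t)²)`. -/
theorem hasDerivAt_exp_mul_sq_log_mul (k : ℝ) {t : ℝ} (ht : 0 < t) :
    HasDerivAt (fun t : ℝ => Real.exp (k * (Real.log t) ^ 2) * (2 * k * Real.log t / t))
      (2 * k * Real.exp (k * (Real.log t) ^ 2) / t ^ 2 *
        (2 * k * (Real.log t) ^ 2 - Real.log t + 1)) t := by
  have h := (hasDerivAt_exp_mul_sq_log k ht).mul
    (((Real.hasDerivAt_log ht.ne').const_mul (2 * k)).div (hasDerivAt_id t) ht.ne')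
  refine h.congr_deriv ?_
  simp only [id_eq, Pi.div_apply]
  field_simp
  ring

/-- For a real `k̂ > 0`, the function `t ↦ exp(k̂ (log t)²)` is convex
on `(0, ∞)` if and only if `k̂ ≥ 1/8`. -/
theorem convexOn_exp_sq_log_iff (khat : ℝ) (hkhat : 0 < khat) :
    ConvexOn ℝ (Set.Ioi (0 : ℝ)) (fun t : ℝ => Real.exp (khat * (Real.log t) ^ 2)) ↔
      khat ≥ 1 / 8 := by
  constructor
  · intro h
    have hmono : MonotoneOn (fun t : ℝ => Real.exp (khat * (Real.log t) ^ 2) *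
        (2 * khat * Real.log t / t)) (Ioi 0) :=
      (h.monotoneOn_deriv fun t ht =>
        (hasDerivAt_exp_mul_sq_log khat ht).differentiableAt).congr
        fun t ht => (hasDerivAt_exp_mul_sq_log khat ht).deriv
    have hpos := Real.exp_pos (1 / (4 * khat))
    have hnonneg := hmono.derivWithin_nonneg (x := Real.exp (1 / (4 * khat)))
    rw [derivWithin_of_isOpen isOpen_Ioi hpos,
      (hasDerivAt_exp_mul_sq_log_mul khat hpos).deriv, Real.log_exp] at hnonneg
    have hquad := nonneg_of_mul_nonneg_right hnonneg (by positivity)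
    have heq : 2 * khat * (1 / (4 * khat)) ^ 2 - 1 / (4 * khat) + 1 =
        (8 * khat - 1) / (8 * khat) := by
      field_simp
      ring
    rw [heq, le_div_iff₀ (by positivity)] at hquad
    linarith
  · intro hk
    refine convexOn_of_hasDerivWithinAt2_nonneg (convex_Ioi 0)
      (fun t ht => (hasDerivAt_exp_mul_sq_log khat ht).continuousAt.continuousWithinAt)
      (fun t ht => (hasDerivAt_exp_mul_sq_log khat (interior_subset ht)).hasDerivWithinAt)
      (fun t ht => (hasDerivAt_exp_mul_sq_log_mul khat (interior_subset ht)).hasDerivWithinAt)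
      fun t ht => mul_nonneg (by positivity) ?_
    nlinarith [sq_nonneg (Real.log t - 2),
      mul_nonneg (sub_nonneg.2 hk) (sq_nonneg (Real.log t))]
end

section
/- Let n ≥ 1 and let k̂ ≥ 1/8. Then the volumetric energy W_vol(F) = exp(k̂·(log det F)²) is rank-one convex on GL⁺(n): for every n×n real matrix F and all vectors ξ, η ∈ ℝⁿ, the function t ↦ exp(k̂·(log det(F + t·ξηᵀ))²) is convex on the set {t ∈ ℝ : det(F + t·ξηᵀ) > 0} (this set is convex, since t ↦ det(F + t·ξηᵀ) is an affine function of t because ξηᵀ has rank at most one). -/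
/-- The determinant is affine along lines in a rank-one direction. -/
theorem Matrix.exists_det_add_smul_vecMulVec {m R : Type*} [Fintype m] [DecidableEq m]
    [CommRing R] (A : Matrix m m R) (u v : m → R) :
    ∃ c : R, ∀ t : R, (A + t • vecMulVec u v).det = A.det + t * c := by
  let M : Matrix (m ⊕ Unit) (m ⊕ Unit) R := fromBlocks A 0 (-replicateRow Unit v) 1
  let a : m ⊕ Unit → R := Sum.elim (fun _ => 0) (fun _ => 1)
  let b : m ⊕ Unit → R := Sum.elim u (fun _ => 0)
  refine ⟨M.cramer b (Sum.inr ()), fun t => ?_⟩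
  have key (t : R) : (A + t • vecMulVec u v).det =
      M.cramer (a + t • b) (Sum.inr ()) := by
    have h : M.updateCol (Sum.inr ()) (a + t • b) =
        fromBlocks A (replicateCol Unit (t • u)) (-replicateRow Unit v) 1 := by
      ext (i | i) (j | j) <;> simp [M, a, b]
    rw [cramer_apply, h, det_fromBlocks_one₂₂]
    congr 1
    ext i j
    simp [mul_apply, vecMulVec_apply]
  have h₀ := key 0
  rw [zero_smul, add_zero, zero_smul, add_zero] at h₀
  rw [key, map_add, map_smul, h₀, Pi.add_apply, Pi.smul_apply, smul_eq_mul]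

/-- The function `y ↦ exp (k (log y)²)` is convex on the positive reals for `1 / 8 ≤ k`. -/
theorem convexOn_exp_mul_log_sq {k : ℝ} (hk : 1 / 8 ≤ k) :
    ConvexOn ℝ (Set.Ioi 0) fun y : ℝ => Real.exp (k * Real.log y ^ 2) := by
  have hd {y : ℝ} (hy : 0 < y) : HasDerivAt (fun y : ℝ => Real.exp (k * Real.log y ^ 2))
      (Real.exp (k * Real.log y ^ 2) * (2 * k * Real.log y / y)) y := by
    convert (((Real.hasDerivAt_log hy.ne').fun_pow 2).const_mul k).exp using 1
    norm_num
    ring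
  have hd' {y : ℝ} (hy : 0 < y) :
      HasDerivAt (fun y : ℝ => Real.exp (k * Real.log y ^ 2) * (2 * k * Real.log y / y))
      (Real.exp (k * Real.log y ^ 2) *
        (2 * k * (2 * k * Real.log y ^ 2 - Real.log y + 1) / y ^ 2)) y := by
    refine ((hd hy).fun_mul (((Real.hasDerivAt_log hy.ne').const_mul (2 * k)).fun_div
      (hasDerivAt_id' y) hy.ne')).congr_deriv ?_
    field_simp
    ring
  refine convexOn_of_hasDerivWithinAt2_nonneg (convex_Ioi 0)
    (fun y hy => (hd hy).continuousAt.continuousWithinAt)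
    (fun y hy => (hd (interior_subset hy)).hasDerivWithinAt)
    (fun y hy => (hd' (interior_subset hy)).hasDerivWithinAt) fun y _ => ?_
  have hq : 0 ≤ 2 * k * Real.log y ^ 2 - Real.log y + 1 := by
    nlinarith [sq_nonneg (Real.log y - 2), sq_nonneg (Real.log y)]
  have hk₀ : 0 ≤ k := by linarith
  positivity


/-- Rank-one convexity of the volumetric energy `F ↦ exp(k̂ (log det F)²)` on `GL⁺(n)`
for `k̂ ≥ 1/8`: along every rank-one line `t ↦ F + t ξηᵀ`, the energy is convex on the
set of parameters `t` where the determinant is positive. -/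
theorem rankOneConvex_vol_energy (n : ℕ) (hn : 1 ≤ n) (khat : ℝ) (hkhat : 1 / 8 ≤ khat)
    (F : Matrix (Fin n) (Fin n) ℝ) (ξ η : Fin n → ℝ) :
    ConvexOn ℝ {t : ℝ | 0 < (F + t • Matrix.vecMulVec ξ η).det}
      (fun t : ℝ => Real.exp (khat * (Real.log (F + t • Matrix.vecMulVec ξ η).det) ^ 2)) := by
  obtain ⟨c, hc⟩ := Matrix.exists_det_add_smul_vecMulVec F ξ η
  have hline (t : ℝ) : AffineMap.lineMap F.det (F.det + c) t = F.det + t * c := by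
    simp [AffineMap.lineMap_apply, add_comm]
  simpa [Set.preimage, Function.comp_def, hc, hline] using
    (convexOn_exp_mul_log_sq hkhat).comp_affineMap (AffineMap.lineMap F.det (F.det + c))
end

section
/- Let p > 0 and q > 0 be real numbers. Then the function f(a, b) = aᵖ/b^q is convex on the set {(a, b) ∈ ℝ² : a ≥ 0, b > 0} if and only if q ≤ p − 1. -/
/-- The tangent plane of `u ^ p / v ^ q` at `(1, 1)` lies below its graph. -/
lemma tangent_le_rpow_div_rpow {p q u v : ℝ} (hq : 0 < q) (hqp : q ≤ p - 1)
    (hu : 0 ≤ u) (hv : 0 < v) :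
    1 + p * (u - 1) - q * (v - 1) ≤ u ^ p / v ^ q := by
  have hp : 0 < p := by linarith
  have amgm := Real.geom_mean_le_arith_mean3_weighted (w₁ := 1 / p) (w₂ := q / p)
    (w₃ := (p - 1 - q) / p) (p₁ := u ^ p / v ^ q) (p₂ := v) (p₃ := 1)
    (by positivity) (by positivity) (div_nonneg (by linarith) hp.le)
    (by positivity) hv.le zero_le_one (by field_simp; ring)
  have hgeom : (u ^ p / v ^ q) ^ (1 / p) * v ^ (q / p) * (1 : ℝ) ^ ((p - 1 - q) / p) = u := by
    rw [Real.div_rpow (by positivity) (by positivity), ← Real.rpow_mul hu, ← Real.rpow_mul hv.le,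
      mul_one_div_cancel hp.ne', mul_one_div, Real.rpow_one, Real.one_rpow, mul_one,
      div_mul_cancel₀ _ (by positivity)]
  rw [hgeom] at amgm
  have hsum : p * (1 / p * (u ^ p / v ^ q) + q / p * v + (p - 1 - q) / p * 1)
      = u ^ p / v ^ q + q * v + (p - 1 - q) := by
    field_simp
  have := mul_le_mul_of_nonneg_left amgm hp.le
  linarith

/-- The tangent plane of `x ^ p / y ^ q` at `(a, b)` lies below its graph. -/
lemma tangent_mul_le_rpow_div_rpow {p q a b x y : ℝ} (hq : 0 < q) (hqp : q ≤ p - 1)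
    (ha : 0 < a) (hb : 0 < b) (hx : 0 ≤ x) (hy : 0 < y) :
    a ^ p / b ^ q * (1 + p * (x / a - 1) - q * (y / b - 1)) ≤ x ^ p / y ^ q := by
  have h := mul_le_mul_of_nonneg_left
    (tangent_le_rpow_div_rpow hq hqp (div_nonneg hx ha.le) (div_pos hy hb))
    (by positivity : 0 ≤ a ^ p / b ^ q)
  refine h.trans_eq ?_
  rw [Real.div_rpow hx ha.le, Real.div_rpow hy.le hb.le]
  field_simp

lemma convex_nonneg_prod_pos : Convex ℝ {x : ℝ × ℝ | 0 ≤ x.1 ∧ 0 < x.2} :=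
  (convex_Ici (0 : ℝ)).prod (convex_Ioi (0 : ℝ))

lemma convexOn_rpow_div_rpow {p q : ℝ} (hq : 0 < q) (hqp : q ≤ p - 1) :
    ConvexOn ℝ {x : ℝ × ℝ | 0 ≤ x.1 ∧ 0 < x.2} (fun x : ℝ × ℝ => x.1 ^ p / x.2 ^ q) := by
  refine ⟨convex_nonneg_prod_pos, ?_⟩
  rintro ⟨x₁, y₁⟩ h₁ ⟨x₂, y₂⟩ h₂ s t hs ht hst
  obtain ⟨ha, hb⟩ := convex_nonneg_prod_pos h₁ h₂ hs ht hst
  obtain ⟨hx₁, hy₁⟩ := h₁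
  obtain ⟨hx₂, hy₂⟩ := h₂
  simp only [Prod.smul_mk, Prod.mk_add_mk, smul_eq_mul] at *
  set a := s * x₁ + t * x₂ with ha_def
  set b := s * y₁ + t * y₂ with hb_def
  rcases ha.eq_or_lt with ha0 | ha0
  · rw [← ha0, Real.zero_rpow (by linarith), zero_div]
    positivity
  · have T₁ := mul_le_mul_of_nonneg_left
      (tangent_mul_le_rpow_div_rpow hq hqp ha0 hb hx₁ hy₁) hs
    have T₂ := mul_le_mul_of_nonneg_left
      (tangent_mul_le_rpow_div_rpow hq hqp ha0 hb hx₂ hy₂) ht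
    refine le_trans (le_of_eq ?_) (add_le_add T₁ T₂)
    have hX : s * (x₁ / a) + t * (x₂ / a) = 1 := by
      rw [← mul_div_assoc, ← mul_div_assoc, ← add_div, ← ha_def, div_self ha0.ne']
    have hY : s * (y₁ / b) + t * (y₂ / b) = 1 := by
      rw [← mul_div_assoc, ← mul_div_assoc, ← add_div, ← hb_def, div_self hb.ne']
    linear_combination (-(a ^ p / b ^ q)) * ((1 - p + q) * hst + p * hX - q * hY)

open Filter Topology in
lemma le_sub_one_of_convexOn_rpow_div_rpow {p q : ℝ} (hp : 0 < p) (hq : 0 < q)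
    (h : ConvexOn ℝ {x : ℝ × ℝ | 0 ≤ x.1 ∧ 0 < x.2} (fun x : ℝ × ℝ => x.1 ^ p / x.2 ^ q)) :
    q ≤ p - 1 := by
  have hbound : ∀ s : ℝ, 0 < s →
      (1 / 2 : ℝ) ^ p ≤ 1 / 2 * (1 / 2 + 1 / 2 * s) ^ q := by
    intro s hs
    have hconv := h.2 (show ((1, 1) : ℝ × ℝ) ∈ _ from ⟨zero_le_one, zero_lt_one⟩)
      (show ((0, s) : ℝ × ℝ) ∈ _ from ⟨le_rfl, hs⟩)
      (one_half_pos (α := ℝ)).le (one_half_pos (α := ℝ)).le (add_halves (1 : ℝ))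
    simp only [Prod.smul_mk, Prod.mk_add_mk, smul_eq_mul, Real.one_rpow, Real.zero_rpow hp.ne',
      zero_div, mul_zero, add_zero, mul_one, div_one] at hconv
    rwa [div_le_iff₀ (by positivity)] at hconv
  have hlim : Tendsto (fun s : ℝ => 1 / 2 * (1 / 2 + 1 / 2 * s) ^ q) (𝓝[>] 0)
      (𝓝 (1 / 2 * (1 / 2 + 1 / 2 * 0) ^ q)) := by
    have : Continuous fun s : ℝ => 1 / 2 * (1 / 2 + 1 / 2 * s) ^ q :=
      continuous_const.mul ((by fun_prop : Continuous fun s : ℝ => 1 / 2 + 1 / 2 * s).rpow_const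
        fun _ => Or.inr hq.le)
    exact (this.tendsto 0).mono_left nhdsWithin_le_nhds
  have hle := ge_of_tendsto hlim (eventually_mem_nhdsWithin.mono hbound)
  rw [mul_zero, add_zero, ← Real.rpow_one_add' (by norm_num) (by linarith),
    Real.rpow_le_rpow_left_iff_of_base_lt_one (by norm_num) (by norm_num)] at hle
  linarith

/-- For reals `p, q > 0`, the function `f(a,b) = a^p / b^q` is convex on
`{(a,b) : a ≥ 0, b > 0}` if and only if `q ≤ p - 1`. -/
theorem convexOn_rpow_div_rpow_iff (p q : ℝ) (hp : 0 < p) (hq : 0 < q) :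
    ConvexOn ℝ {x : ℝ × ℝ | 0 ≤ x.1 ∧ 0 < x.2}
      (fun x : ℝ × ℝ => x.1 ^ p / x.2 ^ q) ↔ q ≤ p - 1 :=
  ⟨le_sub_one_of_convexOn_rpow_div_rpow hp hq, convexOn_rpow_div_rpow hq⟩
end
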